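/- arXiv:2202.13190 — 2 statements merged into one kernel-verified Lean document; each statement's English description precedes it below -/
import Mathlib

section
/- Deterministically, in every realization of the (N+M)-truncated long-range model on ℤ³_+ (every configuration of open/closed edges and letters), if the event ∩_{j≥0} D_{4^j} holds — i.e., for every j ∈ ℤ_+ with m = 4^j, the event B_m(η) = {|Γ_m(η)| ≥ m} holds for every finite word η ∈ Ξ_{4m} — then every word ξ ∈ Ξ = {0,1}^ℕ is seen from the origin: there exist pairwise distinct vertices 0 = v_0, v_1, v_2, … in ℤ³_+ such that each ⟨v_{i−1}, v_i⟩ is an open edge (horizontal, or vertical of length at most N+M) and X(v_i) = ξ_i for all i ≥ 1. In other words, {W_0 = Ξ} ⊇ ∩_{j≥0} D_{4^j}. -/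
open MeasureTheory ProbabilityTheory

namespace Stmt8

/-- Base plane `ℤ²₊`. -/
abbrev Z2 := ℕ × ℕ

/-- A configuration of the truncated long-range model on `ℤ³₊ = ℤ²₊ × ℤ₊`:
`openV z h n` is the state of the vertical edge `⟨(z,h),(z,h+n)⟩`, `openH z h j` the state
of the horizontal edge from `(z,h)` in direction `e_{j+1}`, and `letter z h` the letter at
the vertex `(z,h)`. -/
structure Config where
  openV : Z2 → ℕ → ℕ → Bool
  openH : Z2 → ℕ → Fin 2 → Bool
  letter : Z2 → ℕ → Bool

/-- Horizontal neighbour of `z` in direction `j`. -/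
def hnbr (z : Z2) (j : Fin 2) : Z2 := if j = 0 then (z.1 + 1, z.2) else (z.1, z.2 + 1)

/-- The (at most four) neighbours of a vertex of `ℤ²₊`. -/
def nbrs (v : Z2) : Finset Z2 :=
  {(v.1 + 1, v.2), (v.1, v.2 + 1), (v.1 - 1, v.2), (v.1, v.2 - 1)}

/-- External vertex boundary of `A` in `ℤ²₊`. -/
def extB (A : Finset Z2) : Finset Z2 := (A.biUnion nbrs) \ A

/-- State of the exploration: the current sets `A_n`, `B_n` and the height function `ψ`. -/
structure ExpState where
  A : Finset Z2
  B : Finset Z2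
  psi : Z2 → ℕ

/-- The set of indices `i ∈ {lo,…,hi}` witnessing that `x` is black, for parent `y` at
height `h0` with `k = ‖y‖`, in direction `j` (so `x = hnbr y j`). -/
def blackSet (C : Config) (ξ : ℕ → Bool) (y x : Z2) (h0 k : ℕ) (j : Fin 2)
    (lo hi : ℕ) : Finset ℕ :=
  (Finset.Icc lo hi).filter fun i =>
    C.openV y h0 i = true ∧ C.openH y (h0 + i) j = true ∧
    C.letter y (h0 + i) = ξ (2 * k) ∧ C.letter x (h0 + i) = ξ (2 * k + 1)

/-- Update the state after examining the vertex `x` with parent `y`: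
if some index is black, add `x` to `A` with the new height; otherwise add `x` to `B`. -/
def processCand (st : ExpState) (x y : Z2) (cand : Finset ℕ) : ExpState :=
  if h : cand.Nonempty then
    ⟨insert x st.A, st.B, Function.update st.psi x (st.psi y + cand.min' h)⟩
  else ⟨st.A, insert x st.B, st.psi⟩

/-- One step of the exploration, for a fixed ordering `ord` of `ℤ²₊`, a configuration `C`,
a word `ξ` and truncation parameters `N`, `M`. -/
def step (ord : Z2 ≃ ℕ) (C : Config) (ξ : ℕ → Bool) (N M : ℕ) (st : ExpState) : ExpState :=
  let s := extB st.A \ st.B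
  if hs : s.Nonempty then
    let x := ord.symm ((s.image ord).min' (hs.image ord))
    if 1 ≤ x.1 ∧ (x.1 - 1, x.2) ∈ st.A then
      let y := (x.1 - 1, x.2)
      processCand st x y (blackSet C ξ y x (st.psi y) (y.1 + y.2) 0 1 N)
    else if 1 ≤ x.2 ∧ (x.1, x.2 - 1) ∈ st.A then
      let y := (x.1, x.2 - 1)
      processCand st x y (blackSet C ξ y x (st.psi y) (y.1 + y.2) 1 (N + 1) (N + M))
    else ⟨st.A, insert x st.B, st.psi⟩
  else st

/-- The `n`-th state `(A_n, B_n, ψ)` of the exploration, started from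
`A₀ = {(0,0)}`, `B₀ = ∅`, `ψ(0,0) = 0`. -/
def expl (ord : Z2 ≃ ℕ) (C : Config) (ξ : ℕ → Bool) (N M n : ℕ) : ExpState :=
  (step ord C ξ N M)^[n] ⟨{((0, 0) : Z2)}, ∅, fun _ => 0⟩

/-- The limit set `A(ξ) = ⋃ₙ Aₙ`. -/
def ASet (ord : Z2 ≃ ℕ) (C : Config) (ξ : ℕ → Bool) (N M : ℕ) : Set Z2 :=
  ⋃ n, ↑((expl ord C ξ N M n).A)

/-- The middle segment `L_{4m,2} = {(v₁,v₂) ∈ ℤ²₊ : v₁ + v₂ = 4m - 1, m ≤ v₁ < 3m}`. -/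
def Lmid (m : ℕ) : Finset Z2 := (Finset.Ico m (3 * m)).image fun a => (a, 4 * m - 1 - a)

/-- Vertices of `ℤ³₊`, written as (base point, height). -/
abbrev V3 := Z2 × ℕ

/-- `⟨u, w⟩` is an open oriented edge of the configuration `C`, either vertical of length
`1 ≤ n ≤ Kv`, or horizontal. -/
def OpenStep3 (C : Config) (Kv : ℕ) (u w : V3) : Prop :=
  (∃ n, 1 ≤ n ∧ n ≤ Kv ∧ w = (u.1, u.2 + n) ∧ C.openV u.1 u.2 n = true) ∨
  (∃ j : Fin 2, w = (hnbr u.1 j, u.2) ∧ C.openH u.1 u.2 j = true)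

/-- The word `ξ` (with `ξ i` the `(i+1)`-st letter) is seen from `v` in the configuration
`C` of the `Kv`-truncated model on `ℤ³₊`. -/
def Seen3 (C : Config) (Kv : ℕ) (v : V3) (ξ : ℕ → Bool) : Prop :=
  ∃ f : ℕ → V3, f 0 = v ∧ Function.Injective f ∧
    ∀ i : ℕ, OpenStep3 C Kv (f i) (f (i + 1)) ∧ C.letter (f (i + 1)).1 (f (i + 1)).2 = ξ i

/-- The first `L` letters of the word `ξ` from index `k` on can be read along an oriented open
path that starts at `v`. -/
def ReadsFrom (C : Config) (Kv : ℕ) (ξ : ℕ → Bool) : ℕ → ℕ → V3 → Prop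
  | _, 0, _ => True
  | k, L + 1, v => ∃ w, OpenStep3 C Kv v w ∧ C.letter w.1 w.2 = ξ k ∧ ReadsFrom C Kv ξ (k + 1) L w

theorem ReadsFrom.mono {C : Config} {Kv : ℕ} {ξ : ℕ → Bool} {L L' k : ℕ} {v : V3}
    (h : ReadsFrom C Kv ξ k L' v) (hL : L ≤ L') : ReadsFrom C Kv ξ k L v := by
  induction L generalizing L' k v with
  | zero => trivial
  | succ L ih =>
    obtain ⟨L', rfl⟩ : ∃ l, L' = l + 1 := ⟨L' - 1, by omega⟩
    obtain ⟨w, hw, hl, hr⟩ := h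
    exact ⟨w, hw, hl, ih hr (by omega)⟩

theorem finite_setOf_openStep3 (C : Config) (Kv : ℕ) (v : V3) :
    {w | OpenStep3 C Kv v w}.Finite := by
  refine (((Set.finite_Icc 1 Kv).image fun n => ((v.1, v.2 + n) : V3)).union
    (Set.finite_range fun j : Fin 2 => ((hnbr v.1 j, v.2) : V3))).subset ?_
  rintro w (⟨n, h1, h2, rfl, -⟩ | ⟨j, rfl, -⟩)
  · exact Or.inl ⟨n, ⟨h1, h2⟩, rfl⟩
  · exact Or.inr ⟨j, rfl⟩

theorem hnbr_norm (z : Z2) (j : Fin 2) : (hnbr z j).1 + (hnbr z j).2 = z.1 + z.2 + 1 := by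
  unfold hnbr
  split_ifs <;> simp only <;> omega

theorem OpenStep3.norm_lt {C : Config} {Kv : ℕ} {u w : V3} (h : OpenStep3 C Kv u w) :
    u.1.1 + u.1.2 + u.2 < w.1.1 + w.1.2 + w.2 := by
  obtain ⟨n, h1, -, rfl, -⟩ | ⟨j, rfl, -⟩ := h
  · simp only
    omega
  · have := hnbr_norm u.1 j
    simp only
    omega

/-- König's lemma, one step: a vertex from which arbitrarily long pieces of the word can be read
has a successor with the same property. -/
theorem exists_step_forall_readsFrom {C : Config} {Kv : ℕ} {ξ : ℕ → Bool} {k : ℕ} {v : V3}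
    (h : ∀ L, ReadsFrom C Kv ξ k L v) :
    ∃ w, OpenStep3 C Kv v w ∧ C.letter w.1 w.2 = ξ k ∧ ∀ L, ReadsFrom C Kv ξ (k + 1) L w := by
  by_contra! hc
  have hg : ∀ w, ∃ L, OpenStep3 C Kv v w → C.letter w.1 w.2 = ξ k →
      ¬ ReadsFrom C Kv ξ (k + 1) L w := fun w => by
    by_cases hw : OpenStep3 C Kv v w ∧ C.letter w.1 w.2 = ξ k
    · exact (hc w hw.1 hw.2).imp fun _ hL _ _ => hL
    · exact ⟨0, fun h1 h2 => (hw ⟨h1, h2⟩).elim⟩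
  choose g hg using hg
  obtain ⟨b, hb⟩ := ((finite_setOf_openStep3 C Kv v).image g).bddAbove
  obtain ⟨w, hw, hl, hr⟩ := h (b + 1)
  exact hg w hw hl (hr.mono (hb ⟨w, hw, rfl⟩))

theorem seen3_of_forall_readsFrom {C : Config} {Kv : ℕ} {ξ : ℕ → Bool} {v : V3}
    (h : ∀ L, ReadsFrom C Kv ξ 0 L v) : Seen3 C Kv v ξ := by
  choose nxt hstep hlet hnxt using
    fun (k : ℕ) (u : {u : V3 // ∀ L, ReadsFrom C Kv ξ k L u}) =>
      exists_step_forall_readsFrom u.2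
  let f : (k : ℕ) → {u : V3 // ∀ L, ReadsFrom C Kv ξ k L u} :=
    fun k => Nat.rec ⟨v, h⟩ (fun k u => ⟨nxt k u, hnxt k u⟩) k
  refine ⟨fun k => (f k).1, rfl, ?_, fun i => ⟨hstep i (f i), hlet i (f i)⟩⟩
  have hm : StrictMono fun k => (f k).1.1.1 + (f k).1.1.2 + (f k).1.2 :=
    strictMono_nat_of_lt_succ fun k => (hstep k (f k)).norm_lt
  intro a b hab
  apply hm.injective
  simp only at hab ⊢
  rw [hab]

/-- Every explored vertex is the end of an open path from the origin along which the word has been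
read, in the sense that anything read further on extends to the origin. -/
def ReadsToExplored (C : Config) (Kv : ℕ) (ξ : ℕ → Bool) (st : ExpState) : Prop :=
  ∀ x ∈ st.A, ∀ L, ReadsFrom C Kv ξ (2 * (x.1 + x.2)) L (x, st.psi x) →
    ReadsFrom C Kv ξ 0 (2 * (x.1 + x.2) + L) (((0, 0) : Z2), 0)

theorem ReadsToExplored.processCand {C : Config} {Kv : ℕ} {ξ : ℕ → Bool} {st : ExpState}
    (h : ReadsToExplored C Kv ξ st) {x y : Z2} (hx : x ∉ st.A) (hy : y ∈ st.A) {j : Fin 2}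
    (hxy : x = hnbr y j) {lo hi : ℕ} (hlo : 1 ≤ lo) (hhi : hi ≤ Kv) :
    ReadsToExplored C Kv ξ
      (processCand st x y (blackSet C ξ y x (st.psi y) (y.1 + y.2) j lo hi)) := by
  unfold Stmt8.processCand
  split_ifs with hne
  · have hi := Finset.min'_mem _ hne
    set i := Finset.min' _ hne
    simp only [blackSet, Finset.mem_filter, Finset.mem_Icc] at hi
    obtain ⟨⟨hi1, hi2⟩, hV, hH, hl1, hl2⟩ := hi
    intro z hz L hL
    rcases Finset.mem_insert.1 hz with rfl | hz
    · have hn : z.1 + z.2 = y.1 + y.2 + 1 := hxy ▸ hnbr_norm y j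
      simp only [Function.update_self, hn] at hL ⊢
      have := h y hy (L + 2) ⟨(y, st.psi y + i), Or.inl ⟨i, by omega, by omega, rfl, hV⟩, hl1,
        (z, st.psi y + i), Or.inr ⟨j, by rw [hxy], hH⟩, hl2, hL⟩
      exact this.mono (by omega)
    · have hzx : z ≠ x := fun e => hx (e ▸ hz)
      simp only [Function.update_of_ne hzx] at hL
      exact h z hz L hL
  · exact h

theorem ReadsToExplored.step {C : Config} {N M : ℕ} {ξ : ℕ → Bool} {st : ExpState}
    (h : ReadsToExplored C (N + M) ξ st) (ord : Z2 ≃ ℕ) :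
    ReadsToExplored C (N + M) ξ (step ord C ξ N M st) := by
  unfold Stmt8.step
  extract_lets s
  split_ifs with hs
  · extract_lets x
    have hx : x ∉ st.A := by
      obtain ⟨z, hz, hzx⟩ := Finset.mem_image.1 (Finset.min'_mem _ (hs.image ord))
      have hxz : x = z := by simp only [x, ← hzx, Equiv.symm_apply_apply]
      rw [hxz]
      exact (Finset.mem_sdiff.1 (Finset.mem_sdiff.1 hz).1).2
    split_ifs with h1 h2
    · refine h.processCand hx h1.2 ?_ le_rfl (Nat.le_add_right N M)
      simp only [hnbr, if_true, Nat.sub_add_cancel h1.1]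
    · refine h.processCand hx h2.2 ?_ (Nat.le_add_left 1 N) le_rfl
      simp only [hnbr, one_ne_zero, if_false, Nat.sub_add_cancel h2.1]
    · exact h
  · exact h

theorem readsToExplored_expl (ord : Z2 ≃ ℕ) (C : Config) (ξ : ℕ → Bool) (N M n : ℕ) :
    ReadsToExplored C (N + M) ξ (expl ord C ξ N M n) := by
  induction n with
  | zero =>
    intro x hx L hL
    obtain rfl : x = (0, 0) := Finset.mem_singleton.1 hx
    simpa [expl] using hL
  | succ n ih =>
    unfold expl at ih ⊢
    rw [Function.iterate_succ_apply']
    exact ih.step ord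

/-- **Deterministic claim** `{W₀ = Ξ} ⊇ ⋂_j D_{4^j}`.  In every configuration of the
`(N+M)`-truncated model on `ℤ³₊`, if for every `j ≥ 0` (with `m = 4^j`) and every word
`ξ'` we have `|Γ_m| = |A(ξ') ∩ L_{4m,2}| ≥ m` (this is `D_m`, since `A(ξ') ∩ L_{4m,2}`
depends only on the first `2(4m-1)` letters of `ξ'`), then every word is seen from the
origin. -/
theorem stmt8 (ord : Z2 ≃ ℕ) (C : Config) (N M : ℕ)
    (hD : ∀ j : ℕ, ∀ ξ' : ℕ → Bool,
      (4 : ℕ) ^ j ≤ (ASet ord C ξ' N M ∩ ↑(Lmid (4 ^ j))).ncard) :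
    ∀ ξ : ℕ → Bool, Seen3 C (N + M) (((0, 0) : Z2), 0) ξ := by
  intro ξ
  refine seen3_of_forall_readsFrom fun L => ?_
  have hpos : 0 < 4 ^ L := by positivity
  obtain ⟨x, hxA, hxL⟩ := Set.nonempty_of_ncard_ne_zero (hpos.trans_le (hD L ξ)).ne'
  obtain ⟨n, hn⟩ := Set.mem_iUnion.1 hxA
  have hL : L < 4 ^ L := Nat.lt_pow_self (by norm_num)
  have hnorm : L ≤ 2 * (x.1 + x.2) := by
    obtain ⟨a, ha, rfl⟩ := Finset.mem_image.1 (Finset.mem_coe.1 hxL)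
    have := Finset.mem_Ico.1 ha
    simp only
    omega
  exact (readsToExplored_expl ord C ξ N M n x hn 0 trivial).mono hnorm

end Stmt8
end

section
/- Deterministically, in every realization of the (N+M)-truncated long-range model on ℤ³_+ (every configuration of open/closed edges and letters), if the exploration set A(ξ) is infinite, then the word ξ is seen from the origin in the (N+M)-truncated model: there exist pairwise distinct vertices 0 = v_0, v_1, v_2, … in ℤ³_+ such that each ⟨v_{i−1}, v_i⟩ is an open edge (horizontal, or vertical of length at most N+M) and X(v_i) = ξ_i for all i ≥ 1. -/
open MeasureTheory ProbabilityTheory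

namespace Stmt9

/-- Base plane `ℤ²₊`. -/
abbrev Z2 := ℕ × ℕ

/-- A configuration of the truncated long-range model on `ℤ³₊ = ℤ²₊ × ℤ₊`:
`openV z h n` is the state of the vertical edge `⟨(z,h),(z,h+n)⟩`, `openH z h j` the state
of the horizontal edge from `(z,h)` in direction `e_{j+1}`, and `letter z h` the letter at
the vertex `(z,h)`. -/
structure Config where
  openV : Z2 → ℕ → ℕ → Bool
  openH : Z2 → ℕ → Fin 2 → Bool
  letter : Z2 → ℕ → Bool

/-- Horizontal neighbour of `z` in direction `j`. -/
def hnbr (z : Z2) (j : Fin 2) : Z2 := if j = 0 then (z.1 + 1, z.2) else (z.1, z.2 + 1)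

/-- The (at most four) neighbours of a vertex of `ℤ²₊`. -/
def nbrs (v : Z2) : Finset Z2 :=
  {(v.1 + 1, v.2), (v.1, v.2 + 1), (v.1 - 1, v.2), (v.1, v.2 - 1)}

/-- External vertex boundary of `A` in `ℤ²₊`. -/
def extB (A : Finset Z2) : Finset Z2 := (A.biUnion nbrs) \ A

/-- State of the exploration: the current sets `A_n`, `B_n` and the height function `ψ`. -/
structure ExpState where
  A : Finset Z2
  B : Finset Z2
  psi : Z2 → ℕ

/-- The set of indices `i ∈ {lo,…,hi}` witnessing that `x` is black, for parent `y` at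
height `h0` with `k = ‖y‖`, in direction `j` (so `x = hnbr y j`). -/
def blackSet (C : Config) (ξ : ℕ → Bool) (y x : Z2) (h0 k : ℕ) (j : Fin 2)
    (lo hi : ℕ) : Finset ℕ :=
  (Finset.Icc lo hi).filter fun i =>
    C.openV y h0 i = true ∧ C.openH y (h0 + i) j = true ∧
    C.letter y (h0 + i) = ξ (2 * k) ∧ C.letter x (h0 + i) = ξ (2 * k + 1)

/-- Update the state after examining the vertex `x` with parent `y`:
if some index is black, add `x` to `A` with the new height; otherwise add `x` to `B`. -/
def processCand (st : ExpState) (x y : Z2) (cand : Finset ℕ) : ExpState :=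
  if h : cand.Nonempty then
    ⟨insert x st.A, st.B, Function.update st.psi x (st.psi y + cand.min' h)⟩
  else ⟨st.A, insert x st.B, st.psi⟩

/-- One step of the exploration, for a fixed ordering `ord` of `ℤ²₊`, a configuration `C`,
a word `ξ` and truncation parameters `N`, `M`. -/
def step (ord : Z2 ≃ ℕ) (C : Config) (ξ : ℕ → Bool) (N M : ℕ) (st : ExpState) : ExpState :=
  let s := extB st.A \ st.B
  if hs : s.Nonempty then
    let x := ord.symm ((s.image ord).min' (hs.image ord))
    if 1 ≤ x.1 ∧ (x.1 - 1, x.2) ∈ st.A then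
      let y := (x.1 - 1, x.2)
      processCand st x y (blackSet C ξ y x (st.psi y) (y.1 + y.2) 0 1 N)
    else if 1 ≤ x.2 ∧ (x.1, x.2 - 1) ∈ st.A then
      let y := (x.1, x.2 - 1)
      processCand st x y (blackSet C ξ y x (st.psi y) (y.1 + y.2) 1 (N + 1) (N + M))
    else ⟨st.A, insert x st.B, st.psi⟩
  else st

/-- The `n`-th state `(A_n, B_n, ψ)` of the exploration, started from
`A₀ = {(0,0)}`, `B₀ = ∅`, `ψ(0,0) = 0`. -/
def expl (ord : Z2 ≃ ℕ) (C : Config) (ξ : ℕ → Bool) (N M n : ℕ) : ExpState :=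
  (step ord C ξ N M)^[n] ⟨{((0, 0) : Z2)}, ∅, fun _ => 0⟩

/-- The limit set `A(ξ) = ⋃ₙ Aₙ`. -/
def ASet (ord : Z2 ≃ ℕ) (C : Config) (ξ : ℕ → Bool) (N M : ℕ) : Set Z2 :=
  ⋃ n, ↑((expl ord C ξ N M n).A)

/-- The middle segment `L_{4m,2} = {(v₁,v₂) ∈ ℤ²₊ : v₁ + v₂ = 4m - 1, m ≤ v₁ < 3m}`. -/
def Lmid (m : ℕ) : Finset Z2 := (Finset.Ico m (3 * m)).image fun a => (a, 4 * m - 1 - a)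

/-- Vertices of `ℤ³₊`, written as (base point, height). -/
abbrev V3 := Z2 × ℕ

/-- `⟨u, w⟩` is an open oriented edge of the configuration `C`, either vertical of length
`1 ≤ n ≤ Kv`, or horizontal. -/
def OpenStep3 (C : Config) (Kv : ℕ) (u w : V3) : Prop :=
  (∃ n, 1 ≤ n ∧ n ≤ Kv ∧ w = (u.1, u.2 + n) ∧ C.openV u.1 u.2 n = true) ∨
  (∃ j : Fin 2, w = (hnbr u.1 j, u.2) ∧ C.openH u.1 u.2 j = true)

/-- The word `ξ` (with `ξ i` the `(i+1)`-st letter) is seen from `v` in the configuration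
`C` of the `Kv`-truncated model on `ℤ³₊`. -/
def Seen3 (C : Config) (Kv : ℕ) (v : V3) (ξ : ℕ → Bool) : Prop :=
  ∃ f : ℕ → V3, f 0 = v ∧ Function.Injective f ∧
    ∀ i : ℕ, OpenStep3 C Kv (f i) (f (i + 1)) ∧ C.letter (f (i + 1)).1 (f (i + 1)).2 = ξ i

/-- König's lemma: in a finitely branching relation, a vertex with infinitely many descendants
starts an infinite chain. -/
theorem exists_chain_of_infinite {α : Type*} (R : α → α → Prop) (hfin : ∀ u, {w | R u w}.Finite)
    (a : α) (ha : {w | Relation.ReflTransGen R a w}.Infinite) :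
    ∃ g : ℕ → α, g 0 = a ∧ ∀ n, R (g n) (g (n + 1)) := by
  have key : ∀ u : {u : α // {w | Relation.ReflTransGen R u w}.Infinite},
      ∃ w : {u : α // {w | Relation.ReflTransGen R u w}.Infinite}, R u.1 w.1 := by
    rintro ⟨u, hu⟩
    by_contra! hcon
    refine hu ((((hfin u).biUnion (t := fun w => {v | Relation.ReflTransGen R w v})
      fun w hw => ?_).insert u).subset ?_)
    · by_contra hw'
      exact hcon ⟨w, hw'⟩ hw
    · intro v hv
      rcases Relation.ReflTransGen.cases_head hv with rfl | ⟨w, hw, hwv⟩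
      · exact Set.mem_insert _ _
      · exact Set.mem_insert_of_mem _ (Set.mem_biUnion hw hwv)
  choose next hnext using key
  refine ⟨fun n => (next^[n] ⟨a, ha⟩).1, rfl, fun n => ?_⟩
  simp only [Function.iterate_succ_apply']
  exact hnext _

/-- `w` is obtained from `u` by an open vertical edge followed by an open horizontal edge along
which the two letters of `ξ` with indices `2‖u‖` and `2‖u‖ + 1` are read. -/
def DoubleStep (C : Config) (ξ : ℕ → Bool) (K : ℕ) (u w : V3) : Prop :=
  ∃ j : Fin 2, ∃ i ∈ blackSet C ξ u.1 (hnbr u.1 j) u.2 (u.1.1 + u.1.2) j 1 K,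
    w = (hnbr u.1 j, u.2 + i)

theorem finite_doubleStep (C : Config) (ξ : ℕ → Bool) (K : ℕ) (u : V3) :
    {w | DoubleStep C ξ K u w}.Finite := by
  refine ((Set.finite_univ (α := Fin 2)).prod (Finset.finite_toSet (Finset.Icc 1 K))).image
    (fun q : Fin 2 × ℕ => ((hnbr u.1 q.1, u.2 + q.2) : V3)) |>.subset ?_
  rintro w ⟨j, i, hi, rfl⟩
  exact ⟨(j, i), ⟨Set.mem_univ _, (Finset.mem_filter.1 hi).1⟩, rfl⟩

theorem hnbr_fst_add_snd (z : Z2) (j : Fin 2) :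
    (hnbr z j).1 + (hnbr z j).2 = z.1 + z.2 + 1 := by
  unfold hnbr
  split_ifs <;> dsimp only <;> omega

/-- Every vertex of `A`, at its height, is reached from the origin by double steps. -/
def ReachesAll (C : Config) (ξ : ℕ → Bool) (K : ℕ) (st : ExpState) : Prop :=
  ∀ x ∈ st.A, Relation.ReflTransGen (DoubleStep C ξ K) (((0, 0) : Z2), 0) (x, st.psi x)

theorem ReachesAll.processCand {C : Config} {ξ : ℕ → Bool} {K : ℕ} {st : ExpState}
    (h : ReachesAll C ξ K st) {x y : Z2} (hy : y ∈ st.A) {j : Fin 2} (hx : x = hnbr y j)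
    {lo hi : ℕ} (hlo : 1 ≤ lo) (hhi : hi ≤ K) :
    ReachesAll C ξ K
      (processCand st x y (blackSet C ξ y x (st.psi y) (y.1 + y.2) j lo hi)) := by
  unfold Stmt9.processCand
  split_ifs with hne
  · intro v hv
    dsimp only at hv ⊢
    by_cases hvx : v = x
    · subst hvx
      rw [Function.update_self]
      refine (h y hy).tail ⟨j, _, ?_, by rw [← hx]⟩
      rw [← hx]
      exact Finset.filter_subset_filter _ (Finset.Icc_subset_Icc hlo hhi) (Finset.min'_mem _ hne)
    · rw [Function.update_of_ne hvx]
      exact h v (Finset.mem_of_mem_insert_of_ne hv hvx)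
  · exact h

theorem ReachesAll.step {C : Config} {ξ : ℕ → Bool} {N M : ℕ} {st : ExpState}
    (h : ReachesAll C ξ (N + M) st) (ord : Z2 ≃ ℕ) :
    ReachesAll C ξ (N + M) (step ord C ξ N M st) := by
  unfold Stmt9.step
  dsimp only
  split_ifs with _ h1 h2
  · refine h.processCand h1.2 ?_ le_rfl (Nat.le_add_right N M)
    ext <;> simp [hnbr, Nat.sub_add_cancel h1.1]
  · refine h.processCand h2.2 ?_ (Nat.le_add_left 1 N) le_rfl
    ext <;> simp [hnbr, Nat.sub_add_cancel h2.1]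
  · exact h
  · exact h

theorem reachesAll_expl (ord : Z2 ≃ ℕ) (C : Config) (ξ : ℕ → Bool) (N M n : ℕ) :
    ReachesAll C ξ (N + M) (expl ord C ξ N M n) := by
  induction n with
  | zero =>
    intro x hx
    obtain rfl := Finset.mem_singleton.1 hx
    exact Relation.ReflTransGen.refl
  | succ n ih =>
    unfold expl at ih ⊢
    rw [Function.iterate_succ_apply']
    exact ih.step ord

/-- An infinite chain of double steps from the origin yields an embedding of the word `ξ`. -/
theorem seen3_of_chain {C : Config} {ξ : ℕ → Bool} {K : ℕ} (g : ℕ → V3)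
    (h0 : g 0 = (((0, 0) : Z2), 0)) (hg : ∀ n, DoubleStep C ξ K (g n) (g (n + 1))) :
    Seen3 C K (((0, 0) : Z2), 0) ξ := by
  have hnorm : ∀ n, (g n).1.1 + (g n).1.2 = n := by
    intro n
    induction n with
    | zero => simp [h0]
    | succ n ih =>
      obtain ⟨j, i, -, hw⟩ := hg n
      rw [hw, hnbr_fst_add_snd, ih]
  have hstep : ∀ m, OpenStep3 C K ((g (m / 2)).1, (g ((m + 1) / 2)).2)
        ((g ((m + 1) / 2)).1, (g ((m + 1 + 1) / 2)).2) ∧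
      C.letter (g ((m + 1) / 2)).1 (g ((m + 1 + 1) / 2)).2 = ξ m := by
    intro m
    obtain ⟨n, rfl | rfl⟩ := Nat.even_or_odd' m
    · rw [show 2 * n / 2 = n by omega, show (2 * n + 1) / 2 = n by omega,
        show (2 * n + 1 + 1) / 2 = n + 1 by omega]
      obtain ⟨j, i, hi, hw⟩ := hg n
      obtain ⟨hiK, hV, -, hl, -⟩ := Finset.mem_filter.1 hi
      obtain ⟨hi1, hiK⟩ := Finset.mem_Icc.1 hiK
      rw [hw]
      exact ⟨Or.inl ⟨i, hi1, hiK, rfl, hV⟩, by rw [hl, hnorm]⟩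
    · rw [show (2 * n + 1) / 2 = n by omega, show (2 * n + 1 + 1) / 2 = n + 1 by omega,
        show (2 * n + 1 + 1 + 1) / 2 = n + 1 by omega]
      obtain ⟨j, i, hi, hw⟩ := hg n
      obtain ⟨-, -, hH, -, hl⟩ := Finset.mem_filter.1 hi
      rw [hw]
      exact ⟨Or.inr ⟨j, rfl, hH⟩, by rw [hl, hnorm]⟩
  refine ⟨fun m => ((g (m / 2)).1, (g ((m + 1) / 2)).2), by simp [h0], ?_, hstep⟩
  have hmono : StrictMono fun m => (g (m / 2)).1.1 + (g (m / 2)).1.2 + (g ((m + 1) / 2)).2 := by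
    refine strictMono_nat_of_lt_succ fun m => ?_
    rcases (hstep m).1 with ⟨n, hn, -, hw, -⟩ | ⟨j, hw, -⟩ <;>
      obtain ⟨hw1, hw2⟩ := Prod.ext_iff.1 hw <;> dsimp only at hw1 hw2 ⊢ <;> rw [hw1, hw2]
    · omega
    · rw [hnbr_fst_add_snd]
      omega
  exact Function.Injective.of_comp (f := fun v : V3 => v.1.1 + v.1.2 + v.2) hmono.injective

/-- **Deterministic claim.**  In every configuration of the `(N+M)`-truncated model on
`ℤ³₊`, if the exploration set `A(ξ)` is infinite then the word `ξ` is seen from the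
origin. -/
theorem stmt9 (ord : Z2 ≃ ℕ) (C : Config) (ξ : ℕ → Bool) (N M : ℕ)
    (hinf : (ASet ord C ξ N M).Infinite) :
    Seen3 C (N + M) (((0, 0) : Z2), 0) ξ := by
  refine Exists.elim (exists_chain_of_infinite _ (finite_doubleStep C ξ (N + M)) _ ?_)
    fun g hg => seen3_of_chain g hg.1 hg.2
  refine Set.Infinite.of_image Prod.fst (hinf.mono fun x hx => ?_)
  obtain ⟨n, hn⟩ := Set.mem_iUnion.1 hx
  exact ⟨_, reachesAll_expl ord C ξ N M n x hn, rfl⟩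

end Stmt9
end
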